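/- The reflection coefficient at the strong 1-shock is strictly less than 1: let γ>1, let U_b=(u_b,v_b,p_b,ρ_b) with ρ_b>0, p_b>0 and v_b≠0, and U₁=(u,0,p,ρ) with ρ>0, p>0, u>c where c=√(γp/ρ); suppose σ₁₀ satisfies λ₁(U₁) < σ₁₀ < 0 (λ₁(U₁)=−c/√(u²−c²)), p > p_b, and the full Rankine–Hugoniot conditions σ₁₀·(W(U₁)−W(U_b)) = H(U₁)−H(U_b). Set A := DH(U₁) − σ₁₀·DW(U₁) and d := W(U₁) − W(U_b). Then | det( A·r̃₁(U₁), A·r₂(U₁), A·r₃(U₁), d ) | < | det( A·r̃₄(U₁), A·r₂(U₁), A·r₃(U₁), d ) |. -/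

import Mathlib

noncomputable section

/-- The flux map `W` of the 2-D steady full Euler system,
with state `U = (u, v, p, ρ)`. -/
def Wf (γ : ℝ) (U : Fin 4 → ℝ) : Fin 4 → ℝ :=
  ![U 3 * U 0,
    U 3 * U 0 ^ 2 + U 2,
    U 3 * U 0 * U 1,
    U 3 * U 0 * (γ * U 2 / ((γ - 1) * U 3) + (U 0 ^ 2 + U 1 ^ 2) / 2)]

/-- The flux map `H` of the 2-D steady full Euler system. -/
def Hf (γ : ℝ) (U : Fin 4 → ℝ) : Fin 4 → ℝ :=
  ![U 3 * U 1,
    U 3 * U 0 * U 1,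
    U 3 * U 1 ^ 2 + U 2,
    U 3 * U 1 * (γ * U 2 / ((γ - 1) * U 3) + (U 0 ^ 2 + U 1 ^ 2) / 2)]

/-- Jacobian matrix of `W` with respect to `(u, v, p, ρ)`. -/
def DW (γ : ℝ) (U : Fin 4 → ℝ) : Matrix (Fin 4) (Fin 4) ℝ :=
  Matrix.of fun i j => fderiv ℝ (fun V => Wf γ V i) U (Pi.single j 1)

/-- Jacobian matrix of `H` with respect to `(u, v, p, ρ)`. -/
def DH (γ : ℝ) (U : Fin 4 → ℝ) : Matrix (Fin 4) (Fin 4) ℝ :=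
  Matrix.of fun i j => fderiv ℝ (fun V => Hf γ V i) U (Pi.single j 1)

/-- The 4×4 matrix whose columns are the listed vectors. -/
def colMat (a b c d : Fin 4 → ℝ) : Matrix (Fin 4) (Fin 4) ℝ :=
  Matrix.of fun i j => ![a, b, c, d] j i

lemma DW_eq (γ u p ρ : ℝ) (hγ : 1 < γ) (hρ : 0 < ρ) :
    DW γ ![u, 0, p, ρ] = !![ρ, 0, 0, u; 2 * ρ * u, 0, 1, u ^ 2; 0, ρ * u, 0, 0;
      γ / (γ - 1) * p + 3 / 2 * ρ * u ^ 2, 0, γ / (γ - 1) * u, u ^ 3 / 2] := by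
  have hg : γ - 1 ≠ 0 := by linarith
  have hP : ∀ i : Fin 4, HasFDerivAt (fun V : Fin 4 → ℝ => V i)
      (ContinuousLinearMap.proj (R := ℝ) (φ := fun _ : Fin 4 => ℝ) i) ![u, 0, p, ρ] :=
    fun i => hasFDerivAt_apply i _
  have e0 := ((hP 3).mul (hP 0)).fderiv
  have e1 := (((hP 3).mul ((hP 0).pow 2)).add (hP 2)).fderiv
  have e2 := (((hP 3).mul (hP 0)).mul (hP 1)).fderiv
  have e3' := ((((hP 2).mul (hP 0)).const_mul (γ / (γ - 1))).add
    (((hP 3).mul (hP 0)).mul ((((hP 0).pow 2).add ((hP 1).pow 2)).const_mul (1 / 2)))).fderiv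
  have ev : (fun V : Fin 4 → ℝ => Wf γ V 3) =ᶠ[nhds ![u, 0, p, ρ]]
      ((fun V : Fin 4 → ℝ => γ / (γ - 1) * (V 2 * V 0)) +
      fun V => V 3 * V 0 * (1 / 2 * (V 0 ^ 2 + V 1 ^ 2))) := by
    have : ∀ᶠ V : Fin 4 → ℝ in nhds ![u, 0, p, ρ], V 3 ≠ 0 := by
      apply (continuous_apply 3).continuousAt.eventually_ne
      simpa using hρ.ne'
    filter_upwards [this] with V hV
    simp [Wf]
    field_simp
  have e3 := ev.fderiv_eq.trans e3'
  ext i j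
  fin_cases i
  · have := congrArg (fun L => L (Pi.single j 1)) e0
    refine (Eq.trans ?_ this).trans ?_
    · rfl
    · fin_cases j <;> simp
  · have := congrArg (fun L => L (Pi.single j 1)) e1
    refine (Eq.trans ?_ this).trans ?_
    · rfl
    · fin_cases j <;> simp <;> ring
  · have := congrArg (fun L => L (Pi.single j 1)) e2
    refine (Eq.trans ?_ this).trans ?_
    · rfl
    · fin_cases j <;> simp
  · have := congrArg (fun L => L (Pi.single j 1)) e3
    refine (Eq.trans ?_ this).trans ?_
    · rfl
    · fin_cases j <;> simp <;> ring

lemma DH_eq (γ u p ρ : ℝ) (hγ : 1 < γ) (hρ : 0 < ρ) :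
    DH γ ![u, 0, p, ρ] = !![0, ρ, 0, 0; 0, ρ * u, 0, 0; 0, 0, 1, 0;
      0, γ / (γ - 1) * p + 1 / 2 * ρ * u ^ 2, 0, 0] := by
  have hg : γ - 1 ≠ 0 := by linarith
  have hP : ∀ i : Fin 4, HasFDerivAt (fun V : Fin 4 → ℝ => V i)
      (ContinuousLinearMap.proj (R := ℝ) (φ := fun _ : Fin 4 => ℝ) i) ![u, 0, p, ρ] :=
    fun i => hasFDerivAt_apply i _
  have e0 := ((hP 3).mul (hP 1)).fderiv
  have e1 := (((hP 3).mul (hP 0)).mul (hP 1)).fderiv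
  have e2 := (((hP 3).mul ((hP 1).pow 2)).add (hP 2)).fderiv
  have e3' := ((((hP 2).mul (hP 1)).const_mul (γ / (γ - 1))).add
    (((hP 3).mul (hP 1)).mul ((((hP 0).pow 2).add ((hP 1).pow 2)).const_mul (1 / 2)))).fderiv
  have ev : (fun V : Fin 4 → ℝ => Hf γ V 3) =ᶠ[nhds ![u, 0, p, ρ]]
      ((fun V : Fin 4 → ℝ => γ / (γ - 1) * (V 2 * V 1)) +
      fun V => V 3 * V 1 * (1 / 2 * (V 0 ^ 2 + V 1 ^ 2))) := by
    have : ∀ᶠ V : Fin 4 → ℝ in nhds ![u, 0, p, ρ], V 3 ≠ 0 := by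
      apply (continuous_apply 3).continuousAt.eventually_ne
      simpa using hρ.ne'
    filter_upwards [this] with V hV
    simp [Hf]
    field_simp
  have e3 := ev.fderiv_eq.trans e3'
  ext i j
  fin_cases i
  · have := congrArg (fun L => L (Pi.single j 1)) e0
    refine (Eq.trans ?_ this).trans ?_
    · rfl
    · fin_cases j <;> simp
  · have := congrArg (fun L => L (Pi.single j 1)) e1
    refine (Eq.trans ?_ this).trans ?_
    · rfl
    · fin_cases j <;> simp
  · have := congrArg (fun L => L (Pi.single j 1)) e2
    refine (Eq.trans ?_ this).trans ?_
    · rfl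
    · fin_cases j <;> simp
  · have := congrArg (fun L => L (Pi.single j 1)) e3
    refine (Eq.trans ?_ this).trans ?_
    · rfl
    · fin_cases j <;> simp <;> ring

/-- The determinant in closed form; `l` is the eigenvalue. -/
lemma det_formula (γ u p ρ s l k h : ℝ) (hγ : 1 < γ) (hρ : 0 < ρ) (hp : 0 < p)
    (hk : k * ρ = γ * p) (hh : h * (γ - 1) = k) (hk0 : 0 < k) (hl : l ^ 2 * (u ^ 2 - k) = k)
    (d : Fin 4 → ℝ) :
    (colMat
        ((DH γ ![u, 0, p, ρ] - s • DW γ ![u, 0, p, ρ]).mulVec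
          ![-l, 1, ρ * l * u, ρ * l * u / k])
        ((DH γ ![u, 0, p, ρ] - s • DW γ ![u, 0, p, ρ]).mulVec ![u, 0, 0, 0])
        ((DH γ ![u, 0, p, ρ] - s • DW γ ![u, 0, p, ρ]).mulVec ![0, 0, 0, ρ])
        d).det = ρ ^ 3 * s ^ 2 * u ^ 3 * ((l - s) * (h * d 2 / l +
          (-(u * h + u ^ 3 / 2) * d 0 + (h + u ^ 2) * d 1 - u * d 3))) := by
  have hg : γ - 1 ≠ 0 := by linarith
  have hl0 : l ≠ 0 := by
    rintro rfl
    norm_num at hl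
    linarith
  have hγp : γ / (γ - 1) * p = ρ * h := by
    field_simp
    linear_combination (-1) * hk - ρ * hh
  have hγ1 : γ / (γ - 1) * k = h + k := by
    field_simp
    linear_combination -hh
  have hγ2 : γ / (γ - 1) = h / k + 1 := by
    field_simp
    linear_combination -hh
  have hu2 : ρ * l * u / k * u = ρ * l + ρ / l := by
    field_simp
    linear_combination hl
  have v1 : (DH γ ![u, 0, p, ρ] - s • DW γ ![u, 0, p, ρ]).mulVec
          ![-l, 1, ρ * l * u, ρ * l * u / k] =
      ![ρ * (1 - s / l), ρ * u * (1 - s / l), ρ * u * (l - s),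
        ρ * (h + u ^ 2 / 2) * (1 - s / l)] := by
    rw [DW_eq γ u p ρ hγ hρ, DH_eq γ u p ρ hγ hρ]
    ext i
    fin_cases i
    · simp [Matrix.mulVec, dotProduct, Fin.sum_univ_succ]
      linear_combination (-s) * hu2
    · simp [Matrix.mulVec, dotProduct, Fin.sum_univ_succ]
      linear_combination (-s * u) * hu2
    · simp [Matrix.mulVec, dotProduct, Fin.sum_univ_succ]
      ring
    · simp [Matrix.mulVec, dotProduct, Fin.sum_univ_succ]
      rw [hγp, hγ2]
      linear_combination (-s * (u ^ 2 / 2) - s * h) * hu2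
  have v2 : (DH γ ![u, 0, p, ρ] - s • DW γ ![u, 0, p, ρ]).mulVec ![u, 0, 0, 0] =
      ![-s * u * ρ, -s * u * (2 * ρ * u), 0, -s * u * (ρ * (h + 3 / 2 * u ^ 2))] := by
    rw [DW_eq γ u p ρ hγ hρ, DH_eq γ u p ρ hγ hρ, hγp]
    ext i
    fin_cases i <;> simp [Matrix.mulVec, dotProduct, Fin.sum_univ_succ] <;> ring
  have v3 : (DH γ ![u, 0, p, ρ] - s • DW γ ![u, 0, p, ρ]).mulVec ![0, 0, 0, ρ] =
      ![-s * ρ * u, -s * ρ * u ^ 2, 0, -s * ρ * (u ^ 3 / 2)] := by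
    rw [DW_eq γ u p ρ hγ hρ, DH_eq γ u p ρ hγ hρ, hγp]
    ext i
    fin_cases i <;> simp [Matrix.mulVec, dotProduct, Fin.sum_univ_succ] <;> ring
  rw [v1, v2, v3]
  simp [colMat, Matrix.det_succ_row_zero, Fin.sum_univ_succ, Fin.succAbove]
  field_simp
  ring

/-- The reflection coefficient at the strong 1-shock is strictly less than 1:
`|det(A r̃₁, A r₂, A r₃, d)| < |det(A r̃₄, A r₂, A r₃, d)|` with
`A = DH(U₁) - σ₁₀ DW(U₁)` and `d = W(U₁) - W(U_b)`. -/
theorem shock1_reflection_lt_one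
    (γ u_b v_b p_b ρ_b u p ρ σ₁₀ : ℝ) (hγ : 1 < γ)
    (hρb : 0 < ρ_b) (hpb : 0 < p_b) (hvb : v_b ≠ 0)
    (hρ : 0 < ρ) (hp : 0 < p)
    (c : ℝ) (hc : c = Real.sqrt (γ * p / ρ)) (hsup : c < u)
    (lam4 : ℝ) (hlam4 : lam4 = c / Real.sqrt (u ^ 2 - c ^ 2))
    (hσ1 : -lam4 < σ₁₀) (hσ2 : σ₁₀ < 0) (hpp : p_b < p)
    (Ub U₁ : Fin 4 → ℝ) (hUb : Ub = ![u_b, v_b, p_b, ρ_b]) (hU₁ : U₁ = ![u, 0, p, ρ])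
    (hRH : σ₁₀ • (Wf γ U₁ - Wf γ Ub) = Hf γ U₁ - Hf γ Ub)
    (A : Matrix (Fin 4) (Fin 4) ℝ) (hA : A = DH γ U₁ - σ₁₀ • DW γ U₁)
    (d : Fin 4 → ℝ) (hd : d = Wf γ U₁ - Wf γ Ub) :
    |(colMat
        (A.mulVec ![lam4, 1, -(ρ * lam4 * u), -(ρ * lam4 * u) / c ^ 2])
        (A.mulVec ![u, 0, 0, 0])
        (A.mulVec ![0, 0, 0, ρ])
        d).det| <
      |(colMat
        (A.mulVec ![-lam4, 1, ρ * lam4 * u, ρ * lam4 * u / c ^ 2])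
        (A.mulVec ![u, 0, 0, 0])
        (A.mulVec ![0, 0, 0, ρ])
        d).det| := by
  have hk0 : 0 < γ * p / ρ := by positivity
  have hc0 : 0 < c := hc ▸ Real.sqrt_pos.2 hk0
  have hc2 : c ^ 2 = γ * p / ρ := by rw [hc, Real.sq_sqrt hk0.le]
  have hcpos : 0 < c ^ 2 := by positivity
  have huc : 0 < u ^ 2 - c ^ 2 := by nlinarith
  have hu : 0 < u := hc0.trans hsup
  have hl0 : 0 < lam4 := by
    rw [hlam4]
    exact div_pos hc0 (Real.sqrt_pos.2 huc)
  have hl : lam4 ^ 2 * (u ^ 2 - c ^ 2) = c ^ 2 := by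
    rw [hlam4, div_pow, Real.sq_sqrt huc.le]
    field_simp
  have hk : c ^ 2 * ρ = γ * p := by rw [hc2]; field_simp
  have hg : 0 < γ - 1 := by linarith
  obtain ⟨h, hhdef⟩ : ∃ h, h = c ^ 2 / (γ - 1) := ⟨_, rfl⟩
  have hh : h * (γ - 1) = c ^ 2 := by rw [hhdef]; field_simp
  have hh0 : 0 < h := by rw [hhdef]; positivity
  have D4 := det_formula γ u p ρ σ₁₀ lam4 (c ^ 2) h hγ hρ hp hk hh hcpos hl d
  have D1 := det_formula γ u p ρ σ₁₀ (-lam4) (c ^ 2) h hγ hρ hp hk hh hcpos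
    (by rw [neg_sq]; exact hl) d
  have e1 : (![- -lam4, 1, ρ * -lam4 * u, ρ * -lam4 * u / c ^ 2] : Fin 4 → ℝ) =
      ![lam4, 1, -(ρ * lam4 * u), -(ρ * lam4 * u) / c ^ 2] := by
    simp
  rw [e1] at D1
  subst hU₁ hA
  rw [D1, D4]
  -- Rankine-Hugoniot
  have r0 := congrFun hRH 0
  have r1 := congrFun hRH 1
  have r2 := congrFun hRH 2
  have r3 := congrFun hRH 3
  have d0 := congrFun hd 0
  have d1 := congrFun hd 1
  have d2 := congrFun hd 2
  have d3 := congrFun hd 3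
  rw [← hd] at r0 r1 r2 r3
  subst hUb
  simp [Wf, Hf] at r0 r1 r2 r3 d0 d1 d2 d3
  generalize d 0 = a0 at *
  generalize d 1 = a1 at *
  generalize d 2 = a2 at *
  generalize d 3 = a3 at *
  have hs : σ₁₀ ≠ 0 := hσ2.ne
  have ha0 : a0 ≠ 0 := by
    rintro rfl
    have : ρ_b * v_b ≠ 0 := mul_ne_zero hρb.ne' hvb
    apply this
    linarith
  have q1 : a1 = u_b * a0 := by
    apply mul_left_cancel₀ hs
    linear_combination r1 - u_b * r0
  have q2 : a2 = σ₁₀ * (u_b * a0) := by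
    linear_combination d2 - u_b * r0
  obtain ⟨Bb, hBb⟩ : ∃ Bb, Bb = γ * p_b / ((γ - 1) * ρ_b) + (u_b ^ 2 + v_b ^ 2) / 2 := ⟨_, rfl⟩
  rw [← hBb] at r3 d3
  have hB : γ * p / ((γ - 1) * ρ) = h := by
    rw [hhdef, hc2]; field_simp
  rw [hB] at d3
  have q3 : a3 = Bb * a0 := by
    apply mul_left_cancel₀ hs
    linear_combination r3 - Bb * r0
  have hBB : Bb = h + u ^ 2 / 2 := by
    have : ρ * u * (Bb - (h + u ^ 2 / 2)) = 0 := by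
      linear_combination d3 - q3 - Bb * d0
    have h2 := (mul_eq_zero.1 this).resolve_left (by positivity)
    linarith
  have hub : ρ * u * (u_b - u) = p - p_b := by
    linear_combination d1 - q1 - u_b * d0
  have hubu : 0 < u_b - u := by
    by_contra hcon
    have : ρ * u * (u_b - u) ≤ 0 :=
      mul_nonpos_of_nonneg_of_nonpos (by positivity) (by linarith)
    linarith
  have hbr : (h + u ^ 2) * (u_b - u) - u * h < 0 := by
    have hρh : ρ * h * (γ - 1) = γ * p := by rw [mul_assoc, hh]; linarith
    have key : (h + u ^ 2) * (p - p_b) - ρ * u ^ 2 * h < 0 := by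
      have t1 : (γ - 1) * ((h + u ^ 2) * (p - p_b) - ρ * u ^ 2 * h) =
          -((u ^ 2 - c ^ 2) * (p + (γ - 1) * p_b)) - h * (γ - 1) * (γ * p_b) := by
        linear_combination (-u ^ 2) * hρh + (p + (γ - 1) * p_b) * hh
      have t2 : 0 < (u ^ 2 - c ^ 2) * (p + (γ - 1) * p_b) := by positivity
      have t3 : 0 < h * (γ - 1) * (γ * p_b) := by positivity
      by_contra hcon
      have := mul_nonneg hg.le (not_lt.1 hcon)
      linarith
    have : ρ * u * ((h + u ^ 2) * (u_b - u) - u * h) < 0 := by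
      have e : ρ * u * ((h + u ^ 2) * (u_b - u) - u * h) =
        (h + u ^ 2) * (p - p_b) - ρ * u ^ 2 * h := by
        linear_combination (h + u ^ 2) * hub
      rw [e]; exact key
    by_contra hcon
    have := mul_nonneg (mul_pos hρ hu).le (not_lt.1 hcon)
    linarith
  obtain ⟨N, hN⟩ : ∃ N, N = -(u * h + u ^ 3 / 2) * a0 + (h + u ^ 2) * a1 - u * a3 := ⟨_, rfl⟩
  obtain ⟨M, hM⟩ : ∃ M, M = h * a2 / lam4 := ⟨_, rfl⟩
  have hN2 : N = a0 * ((h + u ^ 2) * (u_b - u) - u * h) := by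
    rw [hN, q1, q3, hBB]; ring
  have hNM : 0 < N * M := by
    have : N * M = (a0 ^ 2 * (u_b * h / lam4)) *
        ((-σ₁₀) * -((h + u ^ 2) * (u_b - u) - u * h)) := by
      rw [hN2, hM, q2]; ring
    rw [this]
    have hb : 0 < u_b := by linarith
    have ha : 0 < a0 ^ 2 := by positivity
    exact mul_pos (by positivity) (mul_pos (by linarith) (by linarith))
  rw [← hN, ← hM, div_neg, ← hM, abs_mul, abs_mul (ρ ^ 3 * σ₁₀ ^ 2 * u ^ 3)]
  apply mul_lt_mul_of_pos_left _ (by positivity)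
  rw [abs_mul, abs_mul]
  have b1 : |-lam4 - σ₁₀| < |lam4 - σ₁₀| := by
    apply sq_lt_sq.1
    have := mul_pos hl0 (neg_pos.2 hσ2)
    linarith [show (lam4 - σ₁₀) ^ 2 - (-lam4 - σ₁₀) ^ 2 = 4 * (lam4 * -σ₁₀) by ring]
  have b2 : |-M + N| < |M + N| := by
    apply sq_lt_sq.1
    linarith [show (M + N) ^ 2 - (-M + N) ^ 2 = 4 * (N * M) by ring]
  exact mul_lt_mul'' b1 b2 (abs_nonneg _) (abs_nonneg _)
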